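/- There is a universal constant L > 0 and a function ε : ℕ → [0,1] with ε(ℓ) → 0 as ℓ → ∞, such that the following holds. Let ℓ ≥ 2 be an integer, X a finite set, p ∈ (0,1], and let H be an ℓ-bounded hypergraph on X that is not p-small. If m := ⌈L p (log₂ ℓ) |X|⌉ satisfies m ≤ |X|, then a uniformly random m-element subset of X contains an edge of H with probability at least 1 − ε(ℓ). -/

import Mathlib

open Finset

/-- `H` is `p`-small: there is `G ⊆ 2^X` with `H ⊆ ⟨G⟩` and `∑_{S ∈ G} p^{|S|} ≤ 1/2`. -/
def PSmall {α : Type*} (p : ℝ) (H : Finset (Finset α)) : Prop :=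
  ∃ G : Finset (Finset α), (∀ A ∈ H, ∃ S ∈ G, S ⊆ A) ∧ ∑ S ∈ G, p ^ S.card ≤ 1 / 2

/-- The inclusion-minimal members of `{S \ W : S ∈ H}`. -/
def fragments {α : Type*} [DecidableEq α] (H : Finset (Finset α)) (W : Finset α) :
    Finset (Finset α) :=
  (H.image (· \ W)).filter fun T => ∀ S ∈ H, S \ W ⊆ T → S \ W = T

/-- The `m`-subsets of `X` containing no edge of `H`. -/
def missing {α : Type*} [DecidableEq α] (X : Finset α) (m : ℕ) (H : Finset (Finset α)) :
    Finset (Finset α) :=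
  (X.powersetCard m).filter fun W => ¬ ∃ S ∈ H, S ⊆ W

section Fragments

variable {α : Type*} [DecidableEq α] {H : Finset (Finset α)} {W T X : Finset α}

lemma mem_fragments : T ∈ fragments H W ↔
    (∃ S ∈ H, S \ W = T) ∧ ∀ S ∈ H, S \ W ⊆ T → S \ W = T := by
  simp [fragments]

lemma exists_fragment_subset {S : Finset α} (hS : S ∈ H) :
    ∃ T ∈ fragments H W, T ⊆ S := by
  obtain ⟨T, hT, hmin⟩ := (H.image (· \ W)).exists_le_minimal (mem_image_of_mem _ hS)
  refine ⟨T, mem_fragments.2 ⟨by simpa using hmin.prop, fun S' hS' h => ?_⟩,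
    hT.trans sdiff_subset⟩
  exact hmin.eq_of_le (mem_image_of_mem _ hS') h

lemma disjoint_of_mem_fragments (hT : T ∈ fragments H W) : Disjoint W T := by
  obtain ⟨⟨S, -, rfl⟩, -⟩ := mem_fragments.1 hT
  exact disjoint_sdiff

lemma exists_edge_of_mem_fragments (hT : T ∈ fragments H W) :
    ∃ S ∈ H, S \ W = T ∧ S ⊆ W ∪ T := by
  obtain ⟨⟨S, hS, rfl⟩, -⟩ := mem_fragments.1 hT
  exact ⟨S, hS, rfl, by simp⟩

lemma subset_edge_of_mem_fragments (hT : T ∈ fragments H W) {S : Finset α} (hS : S ∈ H)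
    (h : S ⊆ W ∪ T) : T ⊆ S := by
  have h1 := (mem_fragments.1 hT).2 S hS (sdiff_le_iff.2 h)
  rw [← h1]
  exact sdiff_subset

/-- Counting pairs consisting of a `w`-set and one of its fragments of size `t`, through the
union of the two. -/
lemma sum_card_fragments_le {ℓ : ℕ} (hX : ∀ S ∈ H, S ⊆ X) (hℓ : ∀ S ∈ H, #S ≤ ℓ) (w t : ℕ) :
    ∑ W ∈ X.powersetCard w, #{T ∈ fragments H W | #T = t} ≤ (#X).choose (w + t) * ℓ.choose t := by
  classical
  let f : Finset α → Finset α := fun Z => if h : ∃ S ∈ H, S ⊆ Z then h.choose else ∅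
  have hf : ∀ Z, (∃ S ∈ H, S ⊆ Z) → f Z ∈ H ∧ f Z ⊆ Z := by
    intro Z h
    simp only [f, dif_pos h]
    exact h.choose_spec
  have hfc : ∀ Z, #(f Z) ≤ ℓ := by
    intro Z
    by_cases h : ∃ S ∈ H, S ⊆ Z
    · exact hℓ _ (hf Z h).1
    · simp [f, dif_neg h]
  calc ∑ W ∈ X.powersetCard w, #{T ∈ fragments H W | #T = t}
      = #((X.powersetCard w).sigma fun W => {T ∈ fragments H W | #T = t}) := by
        rw [card_sigma]
    _ ≤ #((X.powersetCard (w + t)).sigma fun Z => (f Z).powersetCard t) := by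
        refine card_le_card_of_injOn (fun a => ⟨a.1 ∪ a.2, a.2⟩) ?_ ?_
        · rintro ⟨W, T⟩ h
          simp only [coe_sigma, Set.mem_sigma_iff, mem_coe, mem_powersetCard, mem_filter] at h ⊢
          obtain ⟨⟨hW, hWc⟩, hT, hTc⟩ := h
          obtain ⟨S, hS, hST, hSs⟩ := exists_edge_of_mem_fragments hT
          have hfZ := hf (W ∪ T) ⟨S, hS, hSs⟩
          refine ⟨⟨union_subset hW ?_, ?_⟩, subset_edge_of_mem_fragments hT hfZ.1 hfZ.2, hTc⟩
          · rw [← hST]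
            exact sdiff_subset.trans (hX S hS)
          · rw [card_union_of_disjoint (disjoint_of_mem_fragments hT), hWc, hTc]
        · rintro ⟨W, T⟩ h ⟨W', T'⟩ h' heq
          simp only [coe_sigma, Set.mem_sigma_iff, mem_coe, mem_filter] at h h'
          simp only [Sigma.mk.injEq, heq_eq_eq] at heq
          obtain ⟨h1, rfl⟩ := heq
          have e : W = W' := by
            rw [← union_sdiff_cancel_right (disjoint_of_mem_fragments h.2.1), h1,
              union_sdiff_cancel_right (disjoint_of_mem_fragments h'.2.1)]
          rw [e]
    _ ≤ (#X).choose (w + t) * ℓ.choose t := by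
        rw [card_sigma, ← card_powersetCard, ← smul_eq_mul]
        refine sum_le_card_nsmul _ _ _ fun Z _ => ?_
        rw [card_powersetCard]
        exact Nat.choose_le_choose _ (hfc Z)

lemma choose_add_mul_pow_le {n w : ℕ} {p x : ℝ} (hw : 0 < w) (hp : 0 ≤ p)
    (hx : n * p ≤ x * w) (t : ℕ) :
    (n.choose (w + t) : ℝ) * p ^ t ≤ n.choose w * x ^ t := by
  have hw' : (0 : ℝ) < w := by exact_mod_cast hw
  have hx0 : 0 ≤ x := by
    by_contra! h
    have : 0 ≤ (n : ℝ) * p := by positivity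
    nlinarith
  induction t with
  | zero => simp
  | succ t ih =>
    have key : (n.choose (w + (t + 1)) : ℝ) * w ≤ n.choose (w + t) * n := by
      have h := Nat.choose_succ_right_eq n (w + t)
      have : n.choose (w + (t + 1)) * w ≤ n.choose (w + t) * n := by
        calc n.choose (w + (t + 1)) * w ≤ n.choose (w + t + 1) * (w + t + 1) :=
              Nat.mul_le_mul_left _ (by omega)
          _ = _ := h
          _ ≤ _ := Nat.mul_le_mul_left _ (Nat.sub_le _ _)
      exact_mod_cast this
    refine le_of_mul_le_mul_right ?_ hw'
    calc (n.choose (w + (t + 1)) : ℝ) * p ^ (t + 1) * w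
        = (n.choose (w + (t + 1)) * w) * p ^ (t + 1) := by ring
      _ ≤ (n.choose (w + t) * n) * p ^ (t + 1) := by gcongr
      _ = (n.choose (w + t) * p ^ t) * (n * p) := by ring
      _ ≤ (n.choose w * x ^ t) * (x * w) := by gcongr
      _ = _ := by ring

/-- The expected weight of the large fragments of a random `w`-set is small. -/
lemma sum_weight_fragments_le {ℓ w k : ℕ} {p x : ℝ} (hX : ∀ S ∈ H, S ⊆ X)
    (hℓ : ∀ S ∈ H, #S ≤ ℓ) (hw : 0 < w) (hp : 0 ≤ p) (hx : #X * p ≤ x * w)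
    (hx0 : 0 ≤ x) (hx1 : x ≤ 1) :
    ∑ W ∈ X.powersetCard w, ∑ T ∈ fragments H W with k ≤ #T, p ^ #T
      ≤ 2 ^ ℓ * x ^ k * (#X).choose w := by
  have inner : ∀ W, ∑ T ∈ fragments H W with k ≤ #T, p ^ #T
      = ∑ t ∈ Icc k ℓ, (#{T ∈ fragments H W | #T = t} : ℝ) * p ^ t := by
    intro W
    rw [← sum_fiberwise_of_maps_to (t := Icc k ℓ) (g := fun T => #T)]
    · refine sum_congr rfl fun t ht => ?_
      rw [filter_filter, ← nsmul_eq_mul, ← sum_const]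
      refine sum_congr ?_ fun T hT => by rw [(mem_filter.1 hT).2]
      ext T
      have := (mem_Icc.1 ht).1
      simp only [mem_filter]
      constructor
      · rintro ⟨h, -, h2⟩
        exact ⟨h, h2⟩
      · rintro ⟨h, h2⟩
        exact ⟨h, by omega, h2⟩
    · intro T hT
      obtain ⟨hT, hk⟩ := mem_filter.1 hT
      obtain ⟨S, hS, rfl, -⟩ := exists_edge_of_mem_fragments hT
      exact mem_Icc.2 ⟨hk, (card_le_card sdiff_subset).trans (hℓ S hS)⟩
  simp_rw [inner]
  rw [sum_comm]
  calc ∑ t ∈ Icc k ℓ, ∑ W ∈ X.powersetCard w, (#{T ∈ fragments H W | #T = t} : ℝ) * p ^ t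
      ≤ ∑ t ∈ Icc k ℓ, (ℓ.choose t : ℝ) * (x ^ k * (#X).choose w) := by
        refine sum_le_sum fun t ht => ?_
        rw [← sum_mul]
        have h1 : ∑ W ∈ X.powersetCard w, (#{T ∈ fragments H W | #T = t} : ℝ)
            ≤ (#X).choose (w + t) * ℓ.choose t := by
          exact_mod_cast sum_card_fragments_le hX hℓ w t
        calc _ ≤ ((#X).choose (w + t) * ℓ.choose t : ℝ) * p ^ t := by gcongr
          _ = ℓ.choose t * ((#X).choose (w + t) * p ^ t) := by ring
          _ ≤ ℓ.choose t * ((#X).choose w * x ^ t) :=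
              mul_le_mul_of_nonneg_left (choose_add_mul_pow_le hw hp hx t) (by positivity)
          _ ≤ ℓ.choose t * ((#X).choose w * x ^ k) := by
              have := pow_le_pow_of_le_one hx0 hx1 (mem_Icc.1 ht).1
              gcongr
          _ = _ := by ring
    _ = (∑ t ∈ Icc k ℓ, (ℓ.choose t : ℝ)) * (x ^ k * (#X).choose w) := by rw [sum_mul]
    _ ≤ 2 ^ ℓ * (x ^ k * (#X).choose w) := by
        have h2 : ∑ t ∈ Icc k ℓ, ℓ.choose t ≤ 2 ^ ℓ := by
          rw [← Nat.sum_range_choose]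
          refine sum_le_sum_of_subset fun t ht => ?_
          have := (mem_Icc.1 ht).2
          exact mem_range.2 (by omega)
        have h3 : ∑ t ∈ Icc k ℓ, (ℓ.choose t : ℝ) ≤ 2 ^ ℓ := by exact_mod_cast h2
        gcongr
    _ = _ := by ring

/-- Exposing a random `m`-set in two stages, the first of which has size `w`. -/
lemma choose_mul_card_missing_le {w m : ℕ} (H' : Finset α → Finset (Finset α))
    (hH' : ∀ W, ∀ T ∈ H' W, ∃ S ∈ H, S ⊆ W ∪ T) :
    m.choose w * #(missing X m H)
      ≤ ∑ W ∈ X.powersetCard w, #(missing (X \ W) (m - w) (H' W)) := by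
  calc m.choose w * #(missing X m H)
      = ∑ V ∈ missing X m H, #(V.powersetCard w) := by
        rw [mul_comm, ← smul_eq_mul, ← sum_const]
        refine sum_congr rfl fun V hV => ?_
        rw [card_powersetCard, (mem_powersetCard.1 (mem_filter.1 hV).1).2]
    _ = #((missing X m H).sigma fun V => V.powersetCard w) := by rw [card_sigma]
    _ ≤ #((X.powersetCard w).sigma fun W => missing (X \ W) (m - w) (H' W)) := by
        refine card_le_card_of_injOn (fun a => ⟨a.2, a.1 \ a.2⟩) ?_ ?_
        · rintro ⟨V, W⟩ h
          simp only [coe_sigma, Set.mem_sigma_iff, mem_coe, mem_powersetCard, missing,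
            mem_filter] at h ⊢
          obtain ⟨⟨⟨hVX, hVc⟩, hV⟩, hWV, hWc⟩ := h
          refine ⟨⟨hWV.trans hVX, hWc⟩,
            ⟨sdiff_subset_sdiff hVX subset_rfl, by rw [card_sdiff_of_subset hWV, hVc, hWc]⟩, ?_⟩
          rintro ⟨T, hT, hTV⟩
          obtain ⟨S, hS, hST⟩ := hH' W T hT
          exact hV ⟨S, hS, hST.trans (union_subset hWV (hTV.trans sdiff_subset))⟩
        · rintro ⟨V, W⟩ h ⟨V', W'⟩ h' heq
          simp only [coe_sigma, Set.mem_sigma_iff, mem_coe, mem_powersetCard] at h h'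
          simp only [Sigma.mk.injEq, heq_eq_eq] at heq
          obtain ⟨rfl, h1⟩ := heq
          have e : V = V' := by
            rw [← sdiff_union_of_subset h.2.1, h1, sdiff_union_of_subset h'.2.1]
          rw [e]
    _ = _ := by rw [card_sigma]

end Fragments

lemma half_pow_add_le {ℓ : ℕ} {r : ℝ} (hℓ : 0 < ℓ) (hr : 0 ≤ r) :
    (1 - (1 / 2 : ℝ) ^ (ℓ / 2)) / (1 + r)
      + 2 ^ ℓ * (1 / (16 * (1 + r / ((ℓ / 2 + 1 : ℕ) : ℝ)))) ^ (ℓ / 2 + 1)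
      ≤ (1 - (1 / 2) ^ ℓ) / (1 + r) := by
  set k := ℓ / 2 + 1 with hk
  have hk0 : (0 : ℝ) < (k : ℝ) := by positivity
  have bern : 1 + r ≤ (1 + r / k) ^ k := by
    have := one_add_mul_le_pow (a := r / k) (by have : 0 ≤ r / k := by positivity
                                                linarith) k
    rwa [mul_div_cancel₀ _ hk0.ne'] at this
  have h16 : (2 : ℝ) ^ ℓ * (1 / 16) ^ k ≤ (1 / 2) ^ ℓ := by
    calc (2 : ℝ) ^ ℓ * (1 / 16) ^ k = 2 ^ ℓ * (1 / 4) ^ (2 * k) := by rw [pow_mul]; norm_num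
      _ ≤ 2 ^ ℓ * (1 / 4) ^ ℓ := by
          gcongr 2 ^ ℓ * ?_
          exact pow_le_pow_of_le_one (by norm_num) (by norm_num) (by omega)
      _ = _ := by rw [← mul_pow]; norm_num
  have hhalf : 2 * (1 / 2 : ℝ) ^ ℓ ≤ (1 / 2) ^ (ℓ / 2) := by
    calc 2 * (1 / 2 : ℝ) ^ ℓ = (1 / 2) ^ (ℓ - 1) := by
          obtain ⟨j, rfl⟩ : ∃ j, ℓ = j + 1 := ⟨ℓ - 1, by omega⟩
          rw [pow_succ, Nat.add_sub_cancel]; ring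
      _ ≤ _ := pow_le_pow_of_le_one (by norm_num) (by norm_num) (by omega)
  have h1 : 2 ^ ℓ * (1 / (16 * (1 + r / (k : ℝ)))) ^ k ≤ (1 / 2) ^ ℓ / (1 + r) := by
    calc 2 ^ ℓ * (1 / (16 * (1 + r / (k : ℝ)))) ^ k
        = (2 ^ ℓ * (1 / 16) ^ k) / (1 + r / k) ^ k := by
          rw [div_pow, div_pow, mul_pow]; field_simp
      _ ≤ (1 / 2) ^ ℓ / (1 + r) := by gcongr
  calc _ ≤ (1 - (1 / 2 : ℝ) ^ (ℓ / 2)) / (1 + r) + (1 / 2) ^ ℓ / (1 + r) := by gcongr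
    _ = (1 - (1 / 2 : ℝ) ^ (ℓ / 2) + (1 / 2) ^ ℓ) / (1 + r) := by rw [← add_div]
    _ ≤ _ := by gcongr; linarith

/-- A lower bound on the number of points (in units of `p * |X|`) which suffices to run all
rounds of the fragmentation for an `ℓ`-bounded hypergraph. -/
noncomputable def fragmentationBudget (r : ℝ) (ℓ : ℕ) : ℝ :=
  18 * Nat.clog 2 (ℓ + 1) + 64 * r * (1 - 1 / (ℓ + 1))

lemma fragmentationBudget_nonneg {r : ℝ} (hr : 0 ≤ r) (ℓ : ℕ) : 0 ≤ fragmentationBudget r ℓ := by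
  have : 1 / ((ℓ : ℝ) + 1) ≤ 1 := by
    rw [div_le_one (by positivity)]
    linarith [(Nat.cast_nonneg ℓ : (0 : ℝ) ≤ ℓ)]
  have h2 : 0 ≤ 1 - 1 / ((ℓ : ℝ) + 1) := by linarith
  unfold fragmentationBudget
  positivity

lemma fragmentationBudget_half {r : ℝ} (hr : 0 ≤ r) {ℓ : ℕ} (hℓ : 0 < ℓ) :
    18 + 16 * (r / ((ℓ / 2 + 1 : ℕ) : ℝ)) + fragmentationBudget r (ℓ / 2)
      ≤ fragmentationBudget r ℓ := by
  have hclog : Nat.clog 2 (ℓ + 1) = Nat.clog 2 (ℓ / 2 + 1) + 1 := by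
    rw [Nat.clog_of_two_le (by norm_num) (by omega)]
    congr 2
    omega
  have hh : 1 / (((ℓ / 2 : ℕ) : ℝ) + 1) ≥ (3 / 2) * (1 / ((ℓ : ℝ) + 1)) := by
    have h1 : 3 * (ℓ / 2 + 1) ≤ 2 * (ℓ + 1) := by omega
    have h2 : (3 : ℝ) * (((ℓ / 2 : ℕ) : ℝ) + 1) ≤ 2 * ((ℓ : ℝ) + 1) := by exact_mod_cast h1
    rw [ge_iff_le, mul_one_div, div_le_div_iff₀ (by positivity) (by positivity)]
    linarith
  have hk : 1 / (((ℓ / 2 + 1 : ℕ) : ℝ)) ≤ 2 * (1 / ((ℓ : ℝ) + 1)) := by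
    have h1 : ℓ + 1 ≤ 2 * (ℓ / 2 + 1) := by omega
    have h2 : (ℓ : ℝ) + 1 ≤ 2 * ((ℓ / 2 + 1 : ℕ) : ℝ) := by exact_mod_cast h1
    rw [mul_one_div, div_le_div_iff₀ (by positivity) (by positivity)]
    linarith
  unfold fragmentationBudget
  rw [hclog, div_eq_mul_one_div r]
  push_cast at hk ⊢
  nlinarith [mul_le_mul_of_nonneg_left hk hr, mul_le_mul_of_nonneg_left hh hr]

/-- The probability that a random `m`-set contains no edge, times a lower bound `c` for the
weight of every cover of `H`, is small. -/
lemma card_missing_mul_le {α : Type*} [DecidableEq α] {p q r : ℝ} (hp : 0 < p)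
    (hq : 1 / 2 ≤ q) (hr : 0 ≤ r) (ℓ : ℕ) (X : Finset α) (H : Finset (Finset α)) (m : ℕ) (c : ℝ)
    (hXq : #X * p ≤ q) (hmX : m ≤ #X) (hX : ∀ S ∈ H, S ⊆ X) (hℓ : ∀ S ∈ H, #S ≤ ℓ)
    (hc : ∀ G : Finset (Finset α), (∀ A ∈ H, ∃ S ∈ G, S ⊆ A) → c ≤ ∑ S ∈ G, p ^ #S)
    (hm : q * fragmentationBudget r ℓ ≤ m) :
    #(missing X m H) * c ≤ (1 - (1 / 2) ^ ℓ) / (1 + r) * (#X).choose m := by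
  induction ℓ using Nat.strong_induction_on generalizing X H m c with
  | _ ℓ ih =>
  rcases Nat.eq_zero_or_pos ℓ with rfl | hpos
  · simp only [pow_zero, sub_self, zero_div, zero_mul]
    rcases H.eq_empty_or_nonempty with rfl | ⟨S, hS⟩
    · exact mul_nonpos_of_nonneg_of_nonpos (by positivity) (by simpa using hc ∅ (by simp))
    · obtain rfl : S = ∅ := card_eq_zero.1 (Nat.le_zero.1 (hℓ S hS))
      have : missing X m H = ∅ :=
        filter_eq_empty_iff.2 fun W _ h => h ⟨∅, hS, empty_subset _⟩
      simp [this]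
  set k := ℓ / 2 + 1 with hk
  have hq0 : 0 < q := by linarith
  have hk0 : (0 : ℝ) < (k : ℝ) := by positivity
  set y : ℝ := 16 * (1 + r / k) with hy
  have hrk : 0 ≤ r / k := by positivity
  have hy1 : 1 ≤ y := by linarith
  set w := ⌈y * q⌉₊ with hwdef
  have hw0 : 0 < w := Nat.ceil_pos.2 (by positivity)
  have hwy : y * q ≤ w := Nat.le_ceil _
  have hwlt : (w : ℝ) < y * q + 1 := Nat.ceil_lt_add_one (by positivity)
  have hbudget := mul_le_mul_of_nonneg_left (fragmentationBudget_half hr hpos) hq0.le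
  have hwm' : (w : ℝ) + q * fragmentationBudget r (ℓ / 2) ≤ m := by
    have : y * q + 1 ≤ q * (18 + 16 * (r / k)) := by rw [hy]; linarith
    linarith
  have hwm : w ≤ m := by
    have := mul_nonneg hq0.le (fragmentationBudget_nonneg hr (ℓ / 2))
    have : (w : ℝ) ≤ m := by linarith
    exact_mod_cast this
  let U : Finset α → Finset (Finset α) := fun W => {T ∈ fragments H W | k ≤ #T}
  let H' : Finset α → Finset (Finset α) := fun W => {T ∈ fragments H W | ¬ k ≤ #T}
  let u : Finset α → ℝ := fun W => ∑ T ∈ U W, p ^ #T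
  have hu : ∀ W, 0 ≤ u W := fun W => sum_nonneg fun T _ => by positivity
  set n := #X with hn
  set E : ℝ := (1 - (1 / 2) ^ (ℓ / 2)) / (1 + r) with hE
  have hstep : ∀ W ∈ X.powersetCard w,
      #(missing (X \ W) (m - w) (H' W)) * c ≤ (E + u W) * (n - w).choose (m - w) := by
    intro W hW
    obtain ⟨hWX, hWc⟩ := mem_powersetCard.1 hW
    have hcard : #(X \ W) = n - w := by rw [card_sdiff_of_subset hWX, hWc]
    have hmiss : (#(missing (X \ W) (m - w) (H' W)) : ℝ) ≤ (n - w).choose (m - w) := by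
      rw [← hcard, ← card_powersetCard]
      exact_mod_cast card_le_card (filter_subset _ _)
    have hrec := ih (ℓ / 2) (by omega) (X \ W) (H' W) (m - w) (c - u W) ?_ ?_ ?_ ?_ ?_ ?_
    · rw [hcard] at hrec
      have := mul_le_mul_of_nonneg_right hmiss (hu W)
      linarith
    · refine le_trans ?_ hXq
      have : #(X \ W) ≤ n := card_le_card sdiff_subset
      gcongr
    · rw [hcard]
      omega
    · intro T hT
      obtain ⟨S, hS, rfl, -⟩ := exists_edge_of_mem_fragments (mem_filter.1 hT).1
      exact sdiff_subset_sdiff (hX S hS) subset_rfl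
    · intro T hT
      have := (mem_filter.1 hT).2
      omega
    · intro G hG
      have hcover := hc (U W ∪ G) ?_
      · have h1 := sum_union_inter (s₁ := U W) (s₂ := G) (f := fun S => p ^ #S)
        have h2 : 0 ≤ ∑ S ∈ U W ∩ G, p ^ #S := sum_nonneg fun T _ => by positivity
        simp only [u]
        linarith
      · intro A hA
        obtain ⟨T, hT, hTA⟩ := exists_fragment_subset (W := W) hA
        by_cases hTk : k ≤ #T
        · exact ⟨T, mem_union_left _ (mem_filter.2 ⟨hT, hTk⟩), hTA⟩
        · obtain ⟨S, hS, hST⟩ := hG T (mem_filter.2 ⟨hT, hTk⟩)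
          exact ⟨S, mem_union_right _ hS, hST.trans hTA⟩
    · rw [Nat.cast_sub hwm]
      linarith
  have hE0 : 0 ≤ (1 - (1 / 2 : ℝ) ^ ℓ) / (1 + r) := by
    have : (1 / 2 : ℝ) ^ ℓ ≤ 1 := pow_le_one₀ (by norm_num) (by norm_num)
    have : 0 ≤ 1 - (1 / 2 : ℝ) ^ ℓ := by linarith
    positivity
  rcases le_or_gt c 0 with hc0 | hc0
  · exact (mul_nonpos_of_nonneg_of_nonpos (by positivity) hc0).trans (by positivity)
  have hcount : (m.choose w : ℝ) * #(missing X m H)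
      ≤ ∑ W ∈ X.powersetCard w, (#(missing (X \ W) (m - w) (H' W)) : ℝ) := by
    exact_mod_cast choose_mul_card_missing_le H' fun W T hT => by
      obtain ⟨S, hS, -, hSW⟩ := exists_edge_of_mem_fragments (mem_filter.1 hT).1
      exact ⟨S, hS, hSW⟩
  have hweight : ∑ W ∈ X.powersetCard w, u W ≤ 2 ^ ℓ * (1 / y) ^ k * n.choose w := by
    refine sum_weight_fragments_le hX hℓ hw0 hp.le (hXq.trans ?_) (by positivity)
      ((div_le_one (by linarith)).2 hy1)
    rw [one_div_mul_eq_div, le_div_iff₀ (by linarith)]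
    linarith
  have hmain := half_pow_add_le hpos hr
  have hchoose : (n.choose m : ℝ) * m.choose w = n.choose w * (n - w).choose (m - w) := by
    exact_mod_cast Nat.choose_mul hwm
  have hmw : (0 : ℝ) < m.choose w := by exact_mod_cast Nat.choose_pos hwm
  refine le_of_mul_le_mul_left ?_ hmw
  calc (m.choose w : ℝ) * (#(missing X m H) * c)
      = (m.choose w * #(missing X m H)) * c := by ring
    _ ≤ (∑ W ∈ X.powersetCard w, (#(missing (X \ W) (m - w) (H' W)) : ℝ)) * c := by gcongr
    _ ≤ ∑ W ∈ X.powersetCard w, (E + u W) * (n - w).choose (m - w) := by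
        rw [sum_mul]
        exact sum_le_sum hstep
    _ = (E * n.choose w + ∑ W ∈ X.powersetCard w, u W) * (n - w).choose (m - w) := by
        rw [← sum_mul, sum_add_distrib, sum_const, card_powersetCard, nsmul_eq_mul, mul_comm E]
    _ ≤ (E * n.choose w + 2 ^ ℓ * (1 / y) ^ k * n.choose w) * (n - w).choose (m - w) := by gcongr
    _ = (E + 2 ^ ℓ * (1 / y) ^ k) * (n.choose w * (n - w).choose (m - w)) := by ring
    _ ≤ (1 - (1 / 2) ^ ℓ) / (1 + r) * (n.choose w * (n - w).choose (m - w)) := by gcongr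
    _ = _ := by rw [← hchoose]; ring

lemma fragmentationBudget_logb_le {ℓ : ℕ} (hℓ : 2 ≤ ℓ) :
    fragmentationBudget (Real.logb 2 ℓ) ℓ ≤ 100 * Real.logb 2 ℓ := by
  have hr : 1 ≤ Real.logb 2 ℓ := by
    rw [Real.le_logb_iff_rpow_le (by norm_num) (by positivity)]
    simpa using (by exact_mod_cast hℓ : (2 : ℝ) ≤ ℓ)
  have h1 : Nat.clog 2 (ℓ + 1) ≤ Nat.log 2 ℓ + 1 :=
    Nat.clog_le_of_le_pow (Nat.lt_pow_succ_log_self (by norm_num) ℓ)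
  have h2 : (Nat.clog 2 (ℓ + 1) : ℝ) ≤ Nat.log 2 ℓ + 1 := by exact_mod_cast h1
  have h3 : (Nat.log 2 ℓ : ℝ) ≤ Real.logb 2 ℓ := by simpa using Real.natLog_le_logb ℓ 2
  have h4 : 0 ≤ 1 / ((ℓ : ℝ) + 1) := by positivity
  unfold fragmentationBudget
  nlinarith

lemma half_lt_card_mul_of_not_pSmall {α : Type*} [Fintype α] [DecidableEq α] {p : ℝ}
    {H : Finset (Finset α)} (hH : ¬ PSmall p H) (h0 : ∅ ∉ H) :
    1 / 2 < p * (Fintype.card α : ℝ) := by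
  by_contra! h
  refine hH ⟨univ.image fun a : α => {a}, fun A hA => ?_, ?_⟩
  · obtain ⟨a, ha⟩ := nonempty_iff_ne_empty.2 (ne_of_mem_of_not_mem hA h0)
    exact ⟨{a}, by simp, by simpa using ha⟩
  · rw [sum_image singleton_injective.injOn]
    simpa [mul_comm] using h

/-- Theorem 1.2 (reformulated): there is a universal constant `L > 0` and a function
`ε : ℕ → [0,1]` tending to `0`, such that for any `ℓ`-bounded hypergraph `H` on a finite
set `X` that is not `p`-small, a uniformly random `m`-element subset of `X` with
`m = ⌈L p log₂ ℓ · |X|⌉` contains an edge of `H` with probability at least `1 - ε(ℓ)`. -/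
theorem random_subset_contains_edge :
    ∃ (L : ℝ) (ε : ℕ → ℝ), 0 < L ∧ (∀ ℓ, 0 ≤ ε ℓ ∧ ε ℓ ≤ 1) ∧
      Filter.Tendsto ε Filter.atTop (nhds 0) ∧
      ∀ (α : Type) [Fintype α] [DecidableEq α] (ℓ : ℕ), 2 ≤ ℓ →
        ∀ p : ℝ, 0 < p → p ≤ 1 →
          ∀ H : Finset (Finset α), (∀ S ∈ H, S.card ≤ ℓ) → ¬ PSmall p H →
            ∀ m : ℕ, m = ⌈L * p * Real.logb 2 ℓ * (Fintype.card α : ℝ)⌉₊ →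
              m ≤ Fintype.card α →
              1 - ε ℓ ≤
                ((((Finset.univ : Finset α).powersetCard m).filter
                    fun W => ∃ S ∈ H, S ⊆ W).card : ℝ) /
                  ((Fintype.card α).choose m : ℝ) := by
  refine ⟨100, fun ℓ => min 1 (2 / (1 + Real.logb 2 ℓ)), by norm_num, fun ℓ => ?_, ?_, ?_⟩
  · have : 0 ≤ Real.logb 2 (ℓ : ℝ) := by
      rcases Nat.eq_zero_or_pos ℓ with rfl | h
      · simp
      · exact Real.logb_nonneg (by norm_num) (by exact_mod_cast h)
    exact ⟨le_min zero_le_one (by positivity), min_le_left _ _⟩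
  · have h : Filter.Tendsto (fun ℓ : ℕ => 2 / (1 + Real.logb 2 (ℓ : ℝ))) Filter.atTop (nhds 0) :=
      (Filter.tendsto_atTop_add_const_left _ _
        ((Real.tendsto_logb_atTop (by norm_num)).comp tendsto_natCast_atTop_atTop)).const_div_atTop 2
    simpa using (tendsto_const_nhds (x := (1 : ℝ))).min h
  intro α _ _ ℓ hℓ p hp _ H hHℓ hH m hm hmX
  have hr : 0 ≤ Real.logb 2 (ℓ : ℝ) :=
    Real.logb_nonneg (by norm_num) (by exact_mod_cast (by omega : 1 ≤ ℓ))
  have hch : (0 : ℝ) < (Fintype.card α).choose m := by exact_mod_cast Nat.choose_pos hmX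
  have hsplit : (#{W ∈ (univ : Finset α).powersetCard m | ∃ S ∈ H, S ⊆ W} : ℝ)
      + #(missing univ m H) = (Fintype.card α).choose m := by
    rw [← card_univ, ← card_powersetCard]
    exact_mod_cast card_filter_add_card_filter_not _
  have hmiss : (#(missing univ m H) : ℝ)
      ≤ min 1 (2 / (1 + Real.logb 2 ℓ)) * (Fintype.card α).choose m := by
    rw [min_mul_of_nonneg _ _ hch.le, one_mul]
    refine le_min (by linarith [(Nat.cast_nonneg _ :
      (0 : ℝ) ≤ #{W ∈ (univ : Finset α).powersetCard m | ∃ S ∈ H, S ⊆ W})]) ?_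
    by_cases h0 : ∅ ∈ H
    · have : missing univ m H = ∅ :=
        filter_eq_empty_iff.2 fun W _ h => h ⟨∅, h0, empty_subset _⟩
      rw [this, card_empty, Nat.cast_zero]
      positivity
    have hq := half_lt_card_mul_of_not_pSmall hH h0
    have key := card_missing_mul_le hp hq.le hr ℓ univ H m (1 / 2)
      (by rw [card_univ, mul_comm]) (by rwa [card_univ]) (fun S _ => subset_univ S) hHℓ
      (fun G hG => by
        by_contra! h
        exact hH ⟨G, hG, h.le⟩) ?_
    · rw [card_univ] at key
      have : (1 - (1 / 2 : ℝ) ^ ℓ) / (1 + Real.logb 2 ℓ) ≤ 1 / (1 + Real.logb 2 ℓ) := by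
        gcongr
        linarith [(by positivity : (0 : ℝ) < (1 / 2) ^ ℓ)]
      have h2 := mul_le_mul_of_nonneg_right this hch.le
      have h3 : 2 / (1 + Real.logb 2 (ℓ : ℝ)) = 2 * (1 / (1 + Real.logb 2 ℓ)) := by ring
      rw [h3]
      linarith
    · have h1 := mul_le_mul_of_nonneg_left (fragmentationBudget_logb_le hℓ)
        (by linarith : 0 ≤ p * (Fintype.card α : ℝ))
      refine h1.trans ?_
      rw [hm]
      refine le_trans (le_of_eq ?_) (Nat.le_ceil _)
      ring
  rw [le_div_iff₀ hch]
  linarith
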